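/- arXiv:0811.3047 — 2 statements merged into one kernel-verified Lean document; each statement's English description precedes it below -/
import Mathlib

section
/- (Failure of the wave bilinear estimate below the threshold.) Let k,ℓ ∈ ℝ and b',b₁,b₂ ∈ ℝ. Suppose either (i) ℓ − 2k + 1/2 > 0, or (ii) ℓ − 2k + 1/2 = 0, b',b₁,b₂ ≥ 0 and b'+b₁+b₂ < 5/4. Then there is no constant C such that ‖(Δ/⟨∇⟩)(u · conj(w))‖_{X^{W+}_{ℓ,−b'}} ≤ C ‖u‖_{X^S_{k,b₁}} ‖w‖_{X^S_{k,b₂}} holds for all Schwartz functions u,w on ℝ²×ℝ. -/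
noncomputable section

open MeasureTheory Real
open scoped FourierTransform ENNReal

/-- Space-time ℝ²×ℝ, modeled as ℝ³; the first two coordinates are the spatial
frequency ξ and the last one is the time frequency τ. -/
abbrev SpaceTime : Type := EuclideanSpace ℝ (Fin 3)

/-- |ξ|, the norm of the spatial frequency. -/
def spFreq (ζ : SpaceTime) : ℝ := Real.sqrt (ζ 0 ^ 2 + ζ 1 ^ 2)

/-- τ, the time frequency. -/
def tFreq (ζ : SpaceTime) : ℝ := ζ 2

/-- The Japanese bracket ⟨x⟩ = (1+x²)^{1/2}. -/
def jap (r : ℝ) : ℝ := Real.sqrt (1 + r ^ 2)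

/-- The Schrödinger weight ⟨ξ⟩^k ⟨τ+|ξ|²⟩^b. -/
def wS (k b : ℝ) (ζ : SpaceTime) : ℝ :=
  jap (spFreq ζ) ^ k * jap (tFreq ζ + spFreq ζ ^ 2) ^ b

/-- The wave weight ⟨ξ⟩^ℓ ⟨τ+|ξ|⟩^b. -/
def wW (l b : ℝ) (ζ : SpaceTime) : ℝ :=
  jap (spFreq ζ) ^ l * jap (tFreq ζ + spFreq ζ) ^ b

/-- The norm ‖u‖_{X^S_{k,b}} = ‖⟨ξ⟩^k ⟨τ+|ξ|²⟩^b 𝔉u‖_{L²(ℝ²×ℝ)}. -/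
def XSn (k b : ℝ) (u : SpaceTime → ℂ) : ℝ≥0∞ :=
  eLpNorm (fun ζ => (wS k b ζ : ℂ) * 𝓕 u ζ) 2 volume

/-- The norm ‖v‖_{X^{W+}_{ℓ,b}} = ‖⟨ξ⟩^ℓ ⟨τ+|ξ|⟩^b 𝔉v‖_{L²(ℝ²×ℝ)}. -/
def XWn (l b : ℝ) (v : SpaceTime → ℂ) : ℝ≥0∞ :=
  eLpNorm (fun ζ => (wW l b ζ : ℂ) * 𝓕 v ζ) 2 volume

/-- The operator Δ/⟨∇⟩: the spatial Fourier multiplier with symbol −|ξ|²⟨ξ⟩^{−1}. -/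
def DeltaOp (f : SpaceTime → ℂ) : SpaceTime → ℂ :=
  𝓕⁻ fun ζ => ((-spFreq ζ ^ 2 / jap (spFreq ζ) : ℝ) : ℂ) * 𝓕 f ζ

section Affine

variable {V : Type*} [NormedAddCommGroup V] [InnerProductSpace ℝ V] [FiniteDimensional ℝ V]
  [MeasurableSpace V] [BorelSpace V]

/-- The image of Lebesgue measure under `v ↦ D (v - p)`. -/
lemma map_affine_volume (D : V ≃L[ℝ] V) (p : V) :
    Measure.map (fun v => D (v - p)) volume =
      ENNReal.ofReal |(LinearMap.det (D : V →ₗ[ℝ] V))|⁻¹ • (volume : Measure V) := by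
  have hdet : LinearMap.det (D : V →ₗ[ℝ] V) ≠ 0 := D.toLinearEquiv.isUnit_det'.ne_zero
  have h1 : Measure.map (fun v : V => v - p) volume = volume :=
    (measurePreserving_sub_right volume p).map_eq
  have h2 : (fun v => D (v - p)) = D ∘ (fun v : V => v - p) := rfl
  rw [h2, ← Measure.map_map D.continuous.measurable (by fun_prop), h1, ← abs_inv]
  exact Measure.map_linearMap_addHaar_eq_smul_addHaar volume hdet

lemma eLpNorm_comp_affine (D : V ≃L[ℝ] V) (p : V) (g : V → ℂ) (hg : Continuous g) :
    eLpNorm (fun v => g (D (v - p))) 2 volume =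
      ENNReal.ofReal (|(LinearMap.det (D : V →ₗ[ℝ] V))|⁻¹ ^ (1 / 2 : ℝ)) * eLpNorm g 2 volume := by
  have h := eLpNorm_map_measure (p := 2) (μ := volume) (g := g) (f := fun v => D (v - p))
    hg.aestronglyMeasurable (by fun_prop)
  rw [map_affine_volume, eLpNorm_smul_measure_of_ne_top (by simp)] at h
  rw [show (fun v => g (D (v - p))) = g ∘ (fun v => D (v - p)) from rfl, ← h,
    ENNReal.ofReal_rpow_of_nonneg (by positivity) (by norm_num)]
  simp

lemma integral_comp_affine (D : V ≃L[ℝ] V) (p : V) (g : V → ℂ) (hg : Continuous g) :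
    ∫ v, g (D (v - p)) = |(LinearMap.det (D : V →ₗ[ℝ] V))|⁻¹ • ∫ z, g z := by
  have h := integral_map (μ := volume) (φ := fun v => D (v - p)) (f := g) (by fun_prop)
    hg.aestronglyMeasurable
  rw [map_affine_volume, integral_smul_measure, ENNReal.toReal_ofReal (by positivity)] at h
  exact h.symm

lemma fourierInv_comp_affine (D : V ≃L[ℝ] V) (hD : ∀ x y, inner ℝ (D x) y = inner ℝ x (D y))
    (p x : V) (φ : V → ℂ) (hφ : Continuous φ) :
    𝓕⁻ (fun v => φ (D (v - p))) x = |(LinearMap.det (D : V →ₗ[ℝ] V))|⁻¹ •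
      ((𝐞 (inner ℝ p x) : ℂ) * 𝓕⁻ φ (D.symm x)) := by
  rw [Real.fourierInv_eq, Real.fourierInv_eq, ← integral_const_mul, ← integral_comp_affine D p]
  · congr 1 with v
    have : inner ℝ v x = inner ℝ p x + inner ℝ (D (v - p)) (D.symm x) := by
      rw [hD, D.apply_symm_apply, inner_sub_left]; ring
    rw [this, AddChar.map_add_eq_mul, Circle.smul_def, Circle.smul_def, Circle.coe_mul]
    simp [mul_assoc]
  · simp only [Circle.smul_def]
    fun_prop

lemma fourier_modulate_comp (D : V ≃L[ℝ] V) (hD : ∀ x y, inner ℝ (D x) y = inner ℝ x (D y))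
    (p ζ : V) (G : V → ℂ) (hG : Continuous G) :
    𝓕 (fun x => (𝐞 (inner ℝ p x) : ℂ) * G (D.symm x)) ζ = |(LinearMap.det (D : V →ₗ[ℝ] V))| •
      𝓕 G (D (ζ - p)) := by
  have h' := integral_comp_affine D.symm 0
    (fun x => 𝐞 (-inner ℝ (D x) ζ) • ((𝐞 (inner ℝ p (D x)) : ℂ) * G (D.symm (D x)))) (by
      simp only [Circle.smul_def]
      fun_prop)
  have hds : |LinearMap.det (D.symm : V →ₗ[ℝ] V)|⁻¹ = |LinearMap.det (D : V →ₗ[ℝ] V)| := by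
    have : LinearMap.det (D.symm : V →ₗ[ℝ] V) = (LinearMap.det (D : V →ₗ[ℝ] V))⁻¹ :=
      D.toLinearEquiv.det_coe_symm
    rw [this, abs_inv, inv_inv]
  rw [hds] at h'
  simp only [sub_zero, D.apply_symm_apply, D.symm_apply_apply] at h'
  rw [Real.fourier_eq, Real.fourier_eq, h']
  congr 2 with x
  have : -inner ℝ x (D (ζ - p)) = -inner ℝ (D x) ζ + inner ℝ p (D x) := by
    rw [← hD, inner_sub_right, real_inner_comm p]; ring
  rw [this, AddChar.map_add_eq_mul, Circle.smul_def, Circle.smul_def, Circle.coe_mul]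
  simp [mul_assoc]

end Affine

lemma symbol_hasTemperateGrowth :
    Function.HasTemperateGrowth
      (fun ζ : SpaceTime => ((-spFreq ζ ^ 2 / jap (spFreq ζ) : ℝ) : ℂ)) := by
  let P : SpaceTime →L[ℝ] EuclideanSpace ℝ (Fin 2) :=
    LinearMap.toContinuousLinearMap
      { toFun := fun ζ => !₂[ζ 0, ζ 1]
        map_add' := fun x y => by ext i; fin_cases i <;> simp
        map_smul' := fun c x => by ext i; fin_cases i <;> simp }
  have hP : ∀ ζ, ‖P ζ‖ ^ 2 = spFreq ζ ^ 2 := fun ζ => by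
    rw [spFreq, Real.sq_sqrt (by positivity), EuclideanSpace.norm_sq_eq]
    simp [P, Fin.sum_univ_two]
  have h1 := (Function.hasTemperateGrowth_norm_sq (H := EuclideanSpace ℝ (Fin 2))).neg
  have h2 := Function.hasTemperateGrowth_one_add_norm_sq_rpow (EuclideanSpace ℝ (Fin 2)) (-1 / 2)
  have h3 := (Function.HasTemperateGrowth.comp Function.Complex.hasTemperateGrowth_ofReal (h1.mul h2)).comp P.hasTemperateGrowth
  refine (congrArg Function.HasTemperateGrowth (funext fun ζ => ?_)).mp h3
  have hpos : (0 : ℝ) ≤ 1 + spFreq ζ ^ 2 := by positivity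
  simp only [Function.comp, Pi.mul_apply, Pi.neg_apply, hP, jap, Real.sqrt_eq_rpow, div_eq_mul_inv,
    ← Real.rpow_neg hpos, neg_mul]

lemma exists_schwartz_mul_conj (u w : SchwartzMap SpaceTime ℂ) :
    ∃ h : SchwartzMap SpaceTime ℂ, ⇑h = fun ζ => u ζ * (starRingEnd ℂ) (w ζ) := by
  have hw : Function.HasTemperateGrowth fun ζ => (starRingEnd ℂ) (w ζ) :=
    (Complex.conjCLE.toContinuousLinearMap.hasTemperateGrowth).comp w.hasTemperateGrowth
  refine ⟨SchwartzMap.smulLeftCLM ℂ (fun ζ => (starRingEnd ℂ) (w ζ)) u, ?_⟩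
  ext ζ
  rw [SchwartzMap.smulLeftCLM_apply_apply hw, smul_eq_mul, mul_comm]

lemma fourier_deltaOp (h : SchwartzMap SpaceTime ℂ) :
    𝓕 (DeltaOp h) = fun ζ => ((-spFreq ζ ^ 2 / jap (spFreq ζ) : ℝ) : ℂ) * 𝓕 (⇑h) ζ := by
  have h2 : (fun ζ => ((-spFreq ζ ^ 2 / jap (spFreq ζ) : ℝ) : ℂ) * 𝓕 (⇑h) ζ) =
      ⇑(SchwartzMap.smulLeftCLM ℂ
        (fun ζ : SpaceTime => ((-spFreq ζ ^ 2 / jap (spFreq ζ) : ℝ) : ℂ)) (𝓕 h)) := by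
    ext ζ
    rw [SchwartzMap.smulLeftCLM_apply_apply symbol_hasTemperateGrowth, smul_eq_mul,
      SchwartzMap.fourier_coe]
  rw [DeltaOp, h2, ← SchwartzMap.fourierInv_coe, ← SchwartzMap.fourier_coe,
    FourierTransform.fourier_fourierInv_eq]

/-- The dilation by `d i` in the `i`-th coordinate. -/
def dilation (d : Fin 3 → ℝ) (hd : ∀ i, d i ≠ 0) : SpaceTime ≃L[ℝ] SpaceTime :=
  LinearEquiv.toContinuousLinearEquiv
    { toFun := fun x => WithLp.toLp 2 fun i => d i * x i
      invFun := fun x => WithLp.toLp 2 fun i => (d i)⁻¹ * x i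
      map_add' := fun x y => by ext i; simp [mul_add]
      map_smul' := fun c x => by ext i; simp [mul_left_comm]
      left_inv := fun x => by ext i; simp [hd i]
      right_inv := fun x => by ext i; simp [hd i] }

@[simp] lemma dilation_apply (d : Fin 3 → ℝ) (hd : ∀ i, d i ≠ 0) (x : SpaceTime) (i : Fin 3) :
    dilation d hd x i = d i * x i := rfl

lemma inner_dilation (d : Fin 3 → ℝ) (hd : ∀ i, d i ≠ 0) (x y : SpaceTime) :
    inner ℝ (dilation d hd x) y = inner ℝ x (dilation d hd y) := by
  simp only [PiLp.inner_apply, dilation_apply]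
  congr 1 with i
  simp
  ring

lemma det_dilation (d : Fin 3 → ℝ) (hd : ∀ i, d i ≠ 0) :
    LinearMap.det (dilation d hd : SpaceTime →ₗ[ℝ] SpaceTime) = d 0 * d 1 * d 2 := by
  rw [← LinearMap.det_toMatrix (EuclideanSpace.basisFun (Fin 3) ℝ).toBasis]
  have : LinearMap.toMatrix (EuclideanSpace.basisFun (Fin 3) ℝ).toBasis
      (EuclideanSpace.basisFun (Fin 3) ℝ).toBasis
      (dilation d hd : SpaceTime →ₗ[ℝ] SpaceTime) = Matrix.diagonal d := by
    ext i j
    by_cases h : i = j <;> simp [LinearMap.toMatrix_apply, Matrix.diagonal, h]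
  rw [this, Matrix.det_diagonal, Fin.prod_univ_three]

/-- The Schwartz function whose Fourier transform is `ζ ↦ φ (D (ζ - p))`. -/
lemma exists_schwartz_fourier_eq (D : SpaceTime ≃L[ℝ] SpaceTime)
    (hD : ∀ x y, inner ℝ (D x) y = inner ℝ x (D y)) (φ : SchwartzMap SpaceTime ℂ)
    (p : SpaceTime) :
    ∃ u : SchwartzMap SpaceTime ℂ, (𝓕 ⇑u = fun v => φ (D (v - p))) ∧
      ∀ x, u x = |(LinearMap.det (D : SpaceTime →ₗ[ℝ] SpaceTime))|⁻¹ •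
        ((𝐞 (inner ℝ p x) : ℂ) * (𝓕⁻ φ) (D.symm x)) := by
  have hT : Function.HasTemperateGrowth fun v => D (v - p) :=
    (D.hasTemperateGrowth).comp (Function.HasTemperateGrowth.id'.sub (.const p))
  have hA : AntilipschitzWith ‖(D.symm : SpaceTime →L[ℝ] SpaceTime)‖₊ fun v => D (v - p) := by
    refine AntilipschitzWith.of_le_mul_dist fun x y => ?_
    simpa using D.antilipschitz.le_mul_dist (x - p) (y - p)
  set f := SchwartzMap.compCLMOfAntilipschitz ℝ hT hA φ
  have hf : ⇑f = fun v => φ (D (v - p)) := rfl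
  refine ⟨𝓕⁻ f, ?_, fun x => ?_⟩
  · rw [← SchwartzMap.fourier_coe, FourierTransform.fourier_fourierInv_eq, hf]
  · rw [SchwartzMap.fourierInv_coe, SchwartzMap.fourierInv_coe, hf]
    exact fourierInv_comp_affine D hD p x φ φ.continuous

lemma fourier_mul_conj_eq (D : SpaceTime ≃L[ℝ] SpaceTime)
    (hD : ∀ x y, inner ℝ (D x) y = inner ℝ x (D y)) (p q : SpaceTime)
    (ψ u w : SchwartzMap SpaceTime ℂ)
    (hu : ∀ x, u x = |(LinearMap.det (D : SpaceTime →ₗ[ℝ] SpaceTime))|⁻¹ •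
        ((𝐞 (inner ℝ p x) : ℂ) * ψ (D.symm x)))
    (hw : ∀ x, w x = |(LinearMap.det (D : SpaceTime →ₗ[ℝ] SpaceTime))|⁻¹ •
        ((𝐞 (inner ℝ q x) : ℂ) * ψ (D.symm x))) (ζ : SpaceTime) :
    𝓕 (fun x => u x * (starRingEnd ℂ) (w x)) ζ =
      |(LinearMap.det (D : SpaceTime →ₗ[ℝ] SpaceTime))|⁻¹ •
        𝓕 (fun x => ψ x * (starRingEnd ℂ) (ψ x)) (D (ζ - (p - q))) := by
  have hdet : LinearMap.det (D : SpaceTime →ₗ[ℝ] SpaceTime) ≠ 0 :=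
    D.toLinearEquiv.isUnit_det'.ne_zero
  set J := |(LinearMap.det (D : SpaceTime →ₗ[ℝ] SpaceTime))| with hJ
  have hJ0 : J ≠ 0 := by simpa [hJ] using hdet
  have hG : Continuous fun x => (J : ℂ)⁻¹ * (J : ℂ)⁻¹ * (ψ x * (starRingEnd ℂ) (ψ x)) := by
    have := ψ.continuous
    fun_prop
  have h := fourier_modulate_comp D hD (p - q) ζ _ hG
  have h1 : (fun x => u x * (starRingEnd ℂ) (w x)) = fun x => (𝐞 (inner ℝ (p - q) x) : ℂ) *
      ((J : ℂ)⁻¹ * (J : ℂ)⁻¹ * (ψ (D.symm x) * (starRingEnd ℂ) (ψ (D.symm x)))) := by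
    ext x
    rw [hu, hw, inner_sub_left, AddChar.map_sub_eq_div, Circle.coe_div]
    simp only [Complex.real_smul, map_mul, map_inv₀, Complex.conj_ofReal,
      ← Circle.coe_inv_eq_conj, Circle.coe_inv, Complex.ofReal_inv]
    ring
  rw [h1, h, ← hJ, Real.fourier_eq, Real.fourier_eq, ← integral_smul, ← integral_smul]
  congr 1 with x
  simp only [Circle.smul_def, Complex.real_smul, smul_eq_mul, Complex.ofReal_inv]
  have : (J : ℂ) ≠ 0 := by exact_mod_cast hJ0
  field_simp

lemma eLpNorm_wS_le (D : SpaceTime ≃L[ℝ] SpaceTime) (p : SpaceTime) (φ : SpaceTime → ℂ)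
    (hφ : Continuous φ) (hsupp : ∀ z, φ z ≠ 0 → ‖z‖ ≤ 1) (k b W : ℝ) (hW : 0 ≤ W)
    (h : ∀ ζ, ‖D (ζ - p)‖ ≤ 1 → wS k b ζ ≤ W) :
    eLpNorm (fun ζ => (wS k b ζ : ℂ) * φ (D (ζ - p))) 2 volume ≤
      ENNReal.ofReal (W * |(LinearMap.det (D : SpaceTime →ₗ[ℝ] SpaceTime))|⁻¹ ^ (1 / 2 : ℝ)) *
        eLpNorm φ 2 volume := by
  have h1 := eLpNorm_le_mul_eLpNorm_of_ae_le_mul (μ := volume) (c := W)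
    (f := fun ζ => (wS k b ζ : ℂ) * φ (D (ζ - p))) (g := fun ζ => φ (D (ζ - p)))
    (.of_forall fun ζ => by
      by_cases h0 : φ (D (ζ - p)) = 0
      · simp only [h0, mul_zero, norm_zero, le_refl]
      · have hw : 0 ≤ wS k b ζ := by unfold wS jap; positivity
        rw [norm_mul, Complex.norm_real, Real.norm_of_nonneg hw]
        gcongr
        exact h ζ (hsupp _ h0)) 2
  rwa [eLpNorm_comp_affine D p φ hφ, ← mul_assoc, ← ENNReal.ofReal_mul hW] at h1

lemma le_eLpNorm_wW (D : SpaceTime ≃L[ℝ] SpaceTime) (p : SpaceTime) (φ Φ : SpaceTime → ℂ)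
    (hφ : Continuous φ) (hΦ : Continuous Φ) (hsupp : ∀ z, φ z ≠ 0 → ‖z‖ ≤ 1)
    (hle : ∀ z, ‖φ z‖ ≤ 1) (l b W c : ℝ) (hW : 0 < W) (hc : 0 ≤ c)
    (h : ∀ ζ, ‖D (ζ - p)‖ ≤ 1 → W ≤ wW l b ζ * (spFreq ζ ^ 2 / jap (spFreq ζ))) :
    ENNReal.ofReal (W * c * |(LinearMap.det (D : SpaceTime →ₗ[ℝ] SpaceTime))|⁻¹ ^ (1 / 2 : ℝ)) *
        eLpNorm (fun z => φ z * Φ z) 2 volume ≤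
      eLpNorm (fun ζ => (wW l b ζ : ℂ) * (((-spFreq ζ ^ 2 / jap (spFreq ζ) : ℝ) : ℂ) *
        c • Φ (D (ζ - p)))) 2 volume := by
  have h0 := eLpNorm_comp_affine D p (fun z => φ z * Φ z) (hφ.mul hΦ)
  rw [ENNReal.ofReal_mul (by positivity), mul_assoc, ← h0,
    show ENNReal.ofReal (W * c) = ‖W * c‖ₑ from (Real.enorm_of_nonneg (by positivity)).symm,
    ← eLpNorm_const_smul]
  refine eLpNorm_mono fun ζ => ?_
  simp only [Pi.smul_apply, norm_smul, norm_mul, Complex.norm_real]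
  by_cases h1 : φ (D (ζ - p)) = 0
  · simp only [h1, norm_zero, zero_mul, mul_zero]
    positivity
  have hw : 0 ≤ wW l b ζ := by unfold wW jap; positivity
  have hj : 0 ≤ spFreq ζ ^ 2 / jap (spFreq ζ) := by unfold jap; positivity
  rw [Real.norm_of_nonneg hw, Real.norm_of_nonneg hW.le, neg_div, norm_neg,
    Real.norm_of_nonneg hj]
  calc W * ‖c‖ * (‖φ (D (ζ - p))‖ * ‖Φ (D (ζ - p))‖)
      ≤ (wW l b ζ * (spFreq ζ ^ 2 / jap (spFreq ζ))) * ‖c‖ * (1 * ‖Φ (D (ζ - p))‖) := by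
        gcongr
        · exact h ζ (hsupp _ h1)
        · exact hle _
    _ = wW l b ζ * (spFreq ζ ^ 2 / jap (spFreq ζ) * (‖c‖ * ‖Φ (D (ζ - p))‖)) := by ring

lemma exists_schwartz_bump : ∃ φ : SchwartzMap SpaceTime ℂ, φ 0 = 1 ∧
    (∀ z, φ z ≠ 0 → ‖z‖ ≤ 1) ∧ ∀ z, ‖φ z‖ ≤ 1 := by
  let β : ContDiffBump (0 : SpaceTime) := ⟨1 / 2, 1, by norm_num, by norm_num⟩
  have hsm : ContDiff ℝ (⊤ : ℕ∞) fun z => (β z : ℂ) := Complex.ofRealCLM.contDiff.comp β.contDiff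
  have hcs : HasCompactSupport fun z => (β z : ℂ) :=
    β.hasCompactSupport.comp_left (g := fun x : ℝ => (x : ℂ)) (by simp)
  refine ⟨hcs.toSchwartzMap hsm, ?_, fun z hz => ?_, fun z => ?_⟩
  · change (β 0 : ℂ) = 1
    rw [β.one_of_mem_closedBall (by simp [β.rIn_pos.le])]; simp
  · by_contra! h
    have h0 : (β z : ℂ) = 0 := by rw [β.zero_of_le_dist (by simpa using h.le)]; simp
    exact hz h0
  · change ‖(β z : ℂ)‖ ≤ 1
    rw [Complex.norm_real, Real.norm_of_nonneg β.nonneg]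
    exact β.le_one

lemma integral_mul_conj_ne_zero (ψ : SchwartzMap SpaceTime ℂ) (hψ : ψ ≠ 0) :
    ∫ v, ψ v * (starRingEnd ℂ) (ψ v) ≠ 0 := by
  intro h0
  have h1 : ∫ v, ‖ψ v‖ ^ 2 = 0 := by
    rw [← Complex.ofReal_eq_zero, ← integral_complex_ofReal, ← h0]
    congr 1 with v
    simp [Complex.mul_conj, Complex.normSq_eq_norm_sq]
  have hint : Integrable (fun v => ‖ψ v‖ ^ 2) :=
    (memLp_two_iff_integrable_sq_norm ψ.continuous.aestronglyMeasurable).1 (ψ.memLp 2)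
  rw [integral_eq_zero_iff_of_nonneg (fun _ => by positivity) hint] at h1
  have h2 := (Continuous.ae_eq_iff_eq volume (ψ.continuous.norm.pow 2)
    (continuous_const (y := (0 : ℝ)))).1 h1
  refine hψ (SchwartzMap.ext fun v => ?_)
  simpa using congrFun h2 v

lemma eLpNorm_ne_zero_of_continuous (g : SpaceTime → ℂ) (hg : Continuous g) (z : SpaceTime)
    (hz : g z ≠ 0) : eLpNorm g 2 volume ≠ 0 := by
  rw [Ne, eLpNorm_eq_zero_iff hg.aestronglyMeasurable (by norm_num)]
  intro h0
  exact hz (congrFun ((Continuous.ae_eq_iff_eq volume hg (continuous_const (y := (0 : ℂ)))).1 h0) z)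

/-- A smooth profile together with the non-degeneracy of the autocorrelation it generates. -/
lemma exists_profile : ∃ φ ψ : SchwartzMap SpaceTime ℂ, ∃ Φ : SpaceTime → ℂ, ψ = 𝓕⁻ φ ∧
    Φ = 𝓕 (fun x => ψ x * (starRingEnd ℂ) (ψ x)) ∧ (∀ z, φ z ≠ 0 → ‖z‖ ≤ 1) ∧
    (∀ z, ‖φ z‖ ≤ 1) ∧ Continuous Φ ∧
    eLpNorm φ 2 volume ≠ ∞ ∧ eLpNorm (fun z => φ z * Φ z) 2 volume ≠ 0 := by
  obtain ⟨φ, hφ0, hsupp, hle⟩ := exists_schwartz_bump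
  obtain ⟨ψ, hψ⟩ : ∃ ψ : SchwartzMap SpaceTime ℂ, ψ = 𝓕⁻ φ := ⟨_, rfl⟩
  obtain ⟨Φ, hΦ⟩ : ∃ Φ : SpaceTime → ℂ, Φ = 𝓕 (fun x => ψ x * (starRingEnd ℂ) (ψ x)) := ⟨_, rfl⟩
  have hψ0 : ψ ≠ 0 := by
    rintro rfl
    have h4 : 𝓕 (𝓕⁻ φ) = φ := FourierTransform.fourier_fourierInv_eq φ
    rw [← h4, ← hψ, FourierTransform.fourier_zero] at hφ0
    simp at hφ0
  have hcont : Continuous Φ := by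
    obtain ⟨g, hg⟩ := exists_schwartz_mul_conj ψ ψ
    rw [hΦ, ← hg, ← SchwartzMap.fourier_coe]
    exact (𝓕 g).continuous
  have hΦ0 : Φ 0 ≠ 0 := by
    have := integral_mul_conj_ne_zero ψ hψ0
    simpa [hΦ, Real.fourier_eq] using this
  have hA : eLpNorm φ 2 volume ≠ ∞ := (φ.memLp 2 volume).eLpNorm_ne_top
  have hB : eLpNorm (fun z => φ z * Φ z) 2 volume ≠ 0 :=
    eLpNorm_ne_zero_of_continuous _ (φ.continuous.mul hcont) 0 (by simp [hφ0, hΦ0])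
  exact ⟨φ, ψ, Φ, hψ, hΦ, hsupp, hle, hcont, hA, hB⟩

/-- Testing the bilinear estimate on two frequency-localized bumps. -/
lemma exists_bilinear_test_bound (k ℓ b' b₁ b₂ C : ℝ) (hC : ∀ u w : SchwartzMap SpaceTime ℂ,
      XWn ℓ (-b') (DeltaOp fun ζ => u ζ * (starRingEnd ℂ) (w ζ)) ≤
        ENNReal.ofReal C * XSn k b₁ ⇑u * XSn k b₂ ⇑w) :
    ∃ K : ℝ, 0 ≤ K ∧ ∀ (D : SpaceTime ≃L[ℝ] SpaceTime)
      (_ : ∀ x y, inner ℝ (D x) y = inner ℝ x (D y)) (p q : SpaceTime) (W W₁ W₂ : ℝ),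
      0 < W → 0 ≤ W₁ → 0 ≤ W₂ →
      (∀ ζ, ‖D (ζ - p)‖ ≤ 1 → wS k b₁ ζ ≤ W₁) →
      (∀ ζ, ‖D (ζ - q)‖ ≤ 1 → wS k b₂ ζ ≤ W₂) →
      (∀ ζ, ‖D (ζ - (p - q))‖ ≤ 1 → W ≤ wW ℓ (-b') ζ * (spFreq ζ ^ 2 / jap (spFreq ζ))) →
      W * |(LinearMap.det (D : SpaceTime →ₗ[ℝ] SpaceTime))|⁻¹ ^ (1 / 2 : ℝ) ≤ K * (W₁ * W₂) := by
  obtain ⟨φ, ψ, Φ, hψ, hΦ, hsupp, hle, hcont, hA, hB⟩ := exists_profile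
  set A := eLpNorm φ 2 volume
  set B := eLpNorm (fun z => φ z * Φ z) 2 volume
  refine ⟨(ENNReal.ofReal C * A * A / B).toReal, ENNReal.toReal_nonneg, ?_⟩
  intro D hD p q W W₁ W₂ hW hW₁ hW₂ h₁ h₂ h
  obtain ⟨u, hu, hu'⟩ := exists_schwartz_fourier_eq D hD φ p
  obtain ⟨w, hw, hw'⟩ := exists_schwartz_fourier_eq D hD φ q
  rw [← hψ] at hu' hw'
  have hdet : LinearMap.det (D : SpaceTime →ₗ[ℝ] SpaceTime) ≠ 0 :=
    D.toLinearEquiv.isUnit_det'.ne_zero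
  have hprod := fourier_mul_conj_eq D hD p q ψ u w hu' hw'
  have hup := eLpNorm_wS_le D p φ φ.continuous hsupp k b₁ W₁ hW₁ h₁
  have hwp := eLpNorm_wS_le D q φ φ.continuous hsupp k b₂ W₂ hW₂ h₂
  have hlow := le_eLpNorm_wW D (p - q) φ Φ φ.continuous hcont hsupp hle ℓ (-b') W
    |(LinearMap.det (D : SpaceTime →ₗ[ℝ] SpaceTime))|⁻¹ hW (by positivity) h
  have hmain := hC u w
  obtain ⟨g, hg⟩ := exists_schwartz_mul_conj u w
  simp only [XWn, XSn, ← hg, fourier_deltaOp] at hmain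
  simp only [hg, hprod, hu, hw, ← hΦ] at hmain
  set J := |(LinearMap.det (D : SpaceTime →ₗ[ℝ] SpaceTime))|⁻¹ with hJ
  have hJ0 : 0 < J := by positivity
  set s := J ^ (1 / 2 : ℝ) with hs
  have hs0 : 0 < s := by positivity
  have hss : s * s = J := by rw [hs, ← Real.rpow_add hJ0]; norm_num
  have hfin : ENNReal.ofReal (W * J * s) * B ≤
      (ENNReal.ofReal C * A * A) * ENNReal.ofReal (W₁ * W₂ * J) := by
    calc _ ≤ _ := hlow
      _ ≤ _ := hmain
      _ ≤ ENNReal.ofReal C * (ENNReal.ofReal (W₁ * s) * A) * (ENNReal.ofReal (W₂ * s) * A) := by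
        gcongr
      _ = _ := by
        rw [show W₁ * W₂ * J = (W₁ * s) * (W₂ * s) by rw [← hss]; ring,
          ENNReal.ofReal_mul (p := W₁ * s) (by positivity)]
        ring
  have hBt : B ≠ ∞ := by
    intro hBt
    rw [hBt, ENNReal.mul_top (by simp; positivity), top_le_iff] at hfin
    exact absurd hfin (by finiteness)
  have hKt : ENNReal.ofReal C * A * A / B ≠ ∞ := ENNReal.div_ne_top (by finiteness) hB
  have hfin2 : ENNReal.ofReal (W * J * s) ≤
      (ENNReal.ofReal C * A * A / B) * ENNReal.ofReal (W₁ * W₂ * J) := by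
    rw [← ENNReal.mul_div_right_comm]
    exact (ENNReal.le_div_iff_mul_le (.inl hB) (.inl hBt)).2 hfin
  have := ENNReal.toReal_mono (by finiteness) hfin2
  rw [ENNReal.toReal_mul, ENNReal.toReal_ofReal (by positivity),
    ENNReal.toReal_ofReal (by positivity)] at this
  refine le_of_mul_le_mul_right ?_ hJ0
  linarith

lemma jap_pos (r : ℝ) : 0 < jap r := by unfold jap; positivity

lemma one_le_jap (r : ℝ) : 1 ≤ jap r := Real.one_le_sqrt.2 (by nlinarith [sq_nonneg r])

lemma jap_le {r c : ℝ} (hr : |r| ≤ c) : jap r ≤ 1 + c := by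
  have hc : 0 ≤ c := (abs_nonneg r).trans hr
  refine Real.sqrt_le_iff.2 ⟨by positivity, ?_⟩
  nlinarith [sq_le_sq' (neg_le_of_abs_le hr) (le_of_abs_le hr)]

lemma rpow_le_of_comparable {a N c : ℝ} (k : ℝ) (hc : 1 ≤ c) (hN : 0 < N) (h₁ : N ≤ c * a)
    (h₂ : a ≤ c * N) : a ^ k ≤ c ^ |k| * N ^ k := by
  have hc0 : 0 < c := by linarith
  have ha : 0 < a := by
    by_contra! h
    nlinarith
  rcases le_total 0 k with hk | hk
  · rw [abs_of_nonneg hk, ← Real.mul_rpow hc0.le hN.le]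
    exact Real.rpow_le_rpow ha.le h₂ hk
  · rw [abs_of_nonpos hk, Real.rpow_neg hc0.le, ← Real.inv_rpow hc0.le,
      ← Real.mul_rpow (by positivity) hN.le]
    refine Real.rpow_le_rpow_of_nonpos (by positivity) ?_ hk
    rw [inv_mul_le_iff₀ hc0]
    exact h₁

lemma le_rpow_of_comparable {a N c : ℝ} (k : ℝ) (hc : 1 ≤ c) (hN : 0 < N) (h₁ : N ≤ c * a)
    (h₂ : a ≤ c * N) : (c ^ |k|)⁻¹ * N ^ k ≤ a ^ k := by
  have hc0 : 0 < c := by linarith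
  have ha : 0 < a := by
    by_contra! h
    nlinarith
  have h := rpow_le_of_comparable (a := N) (N := a) k hc ha h₂ h₁
  rwa [inv_mul_le_iff₀ (by positivity)]

lemma jap_rpow_le {r M : ℝ} (b : ℝ) (hM : 1 ≤ M) (hb : M = 1 ∨ 0 ≤ b) (hr : |r| ≤ 7 * M) :
    jap r ^ b ≤ 8 ^ |b| * M ^ b := by
  have h1 := one_le_jap r
  have h2 := jap_le hr
  rcases hb with rfl | hb
  · exact rpow_le_of_comparable b (by norm_num) one_pos (by linarith) (by linarith)
  · rw [abs_of_nonneg hb, ← Real.mul_rpow (by norm_num) (by linarith)]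
    exact Real.rpow_le_rpow (by linarith) (by linarith) hb

lemma le_jap_rpow_neg {r M : ℝ} (b : ℝ) (hM : 1 ≤ M) (hb : M = 1 ∨ 0 ≤ b) (hr : |r| ≤ 7 * M) :
    (8 ^ |b|)⁻¹ * M ^ (-b) ≤ jap r ^ (-b) := by
  have hM0 : 0 < M := by linarith
  rw [Real.rpow_neg hM0.le, Real.rpow_neg (jap_pos r).le, ← mul_inv]
  exact inv_anti₀ (Real.rpow_pos_of_pos (jap_pos r) b) (jap_rpow_le b hM hb hr)

lemma spFreq_sq (ζ : SpaceTime) : spFreq ζ ^ 2 = ζ 0 ^ 2 + ζ 1 ^ 2 :=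
  Real.sq_sqrt (by positivity)

lemma abs_le_spFreq (ζ : SpaceTime) : |ζ 0| ≤ spFreq ζ :=
  Real.abs_le_sqrt (by nlinarith [sq_nonneg (ζ 1)])

lemma jap_spFreq_comparable {N : ℝ} {ζ : SpaceTime} (hN : 2 ≤ N) (h₁ : N / 2 ≤ |ζ 0|)
    (h₂ : |ζ 0| ≤ 4 * N) (h₃ : ζ 1 ^ 2 ≤ N) :
    N ≤ 8 * jap (spFreq ζ) ∧ jap (spFreq ζ) ≤ 8 * N := by
  constructor
  · have : spFreq ζ ≤ jap (spFreq ζ) := Real.le_sqrt_of_sq_le (by linarith)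
    linarith [abs_le_spFreq ζ]
  · refine Real.sqrt_le_iff.2 ⟨by linarith, ?_⟩
    rw [spFreq_sq, ← sq_abs (ζ 0)]
    nlinarith [pow_le_pow_left₀ (abs_nonneg _) h₂ 2]

/-- The dilation adapted to a box of size `M / N × √M × M`. -/
lemma exists_box_dilation {N M : ℝ} (hN : 0 < N) (hM : 0 < M) :
    ∃ D : SpaceTime ≃L[ℝ] SpaceTime, (∀ x y, inner ℝ (D x) y = inner ℝ x (D y)) ∧
      |(LinearMap.det (D : SpaceTime →ₗ[ℝ] SpaceTime))|⁻¹ ^ (1 / 2 : ℝ) =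
        M ^ (5 / 4 : ℝ) * N ^ (-1 / 2 : ℝ) ∧
      ∀ x, ‖D x‖ ≤ 1 → |x 0| ≤ M / N ∧ x 1 ^ 2 ≤ M ∧ |x 2| ≤ M := by
  have hd : ∀ i, (![N / M, M ^ (-1 / 2 : ℝ), M⁻¹] : Fin 3 → ℝ) i ≠ 0 := by
    intro i
    fin_cases i
    · exact (div_pos hN hM).ne'
    · exact (Real.rpow_pos_of_pos hM _).ne'
    · exact (inv_pos.2 hM).ne'
  refine ⟨dilation _ hd, inner_dilation _ hd, ?_, fun x hx => ?_⟩
  · rw [det_dilation]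
    simp only [Matrix.cons_val]
    rw [abs_of_pos (by positivity)]
    have : (N / M * M ^ (-1 / 2 : ℝ) * M⁻¹)⁻¹ = M ^ (5 / 2 : ℝ) * N ^ (-1 : ℝ) := by
      rw [show (5 / 2 : ℝ) = 1 + 1 + 1 / 2 by norm_num, Real.rpow_add hM, Real.rpow_add hM,
        Real.rpow_one, Real.rpow_neg_one, neg_div, Real.rpow_neg hM.le]
      field_simp
    rw [this, Real.mul_rpow (by positivity) (by positivity), ← Real.rpow_mul hM.le,
      ← Real.rpow_mul hN.le]
    norm_num
  · have h := fun i => (PiLp.norm_apply_le (dilation _ hd x) i).trans hx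
    have h0 := h 0
    have h1 := h 1
    have h2 := h 2
    simp only [dilation_apply, Matrix.cons_val, norm_mul, Real.norm_eq_abs] at h0 h1 h2
    refine ⟨?_, ?_, ?_⟩
    · rw [abs_of_pos (by positivity)] at h0
      rw [le_div_iff₀ hN]
      rw [div_mul_eq_mul_div, div_le_one hM] at h0
      linarith
    · rw [abs_of_pos (by positivity), neg_div, Real.rpow_neg hM.le,
        inv_mul_le_iff₀ (by positivity), mul_one, ← Real.sqrt_eq_rpow] at h1
      rw [← sq_abs, ← Real.sq_sqrt hM.le]
      exact pow_le_pow_left₀ (abs_nonneg _) h1 2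
    · rw [abs_of_pos (by positivity), inv_mul_le_iff₀ hM, mul_one] at h2
      exact h2

/-- Near the paraboloid point over `(a, 0)` the Schrödinger weight is comparable to
`N ^ k * M ^ b`. -/
lemma wS_le_of_mem_box {N M a k b : ℝ} {ζ : SpaceTime} (hN : 2 ≤ N) (hM : 1 ≤ M) (hMN : M ≤ N)
    (hb : M = 1 ∨ 0 ≤ b) (ha₁ : N ≤ |a|) (ha₂ : |a| ≤ N + 1) (h₀ : |ζ 0 - a| ≤ M / N)
    (h₁ : ζ 1 ^ 2 ≤ M) (h₂ : |ζ 2 + a ^ 2| ≤ M) :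
    wS k b ζ ≤ (8 ^ |k| * N ^ k) * (8 ^ |b| * M ^ b) := by
  have hN0 : 0 < N := by linarith
  have hδ : M / N ≤ 1 := (div_le_one hN0).2 hMN
  have hNδ : N * (M / N) = M := by field_simp
  set s := ζ 0 - a with hs
  have hζ : ζ 0 = a + s := by rw [hs]; ring
  have hx := abs_add_le a s
  have hx' := abs_sub_abs_le_abs_sub a (-s)
  rw [abs_neg, sub_neg_eq_add] at hx'
  rw [← hζ] at hx hx'
  obtain ⟨hj₁, hj₂⟩ := jap_spFreq_comparable (ζ := ζ) hN (by linarith) (by linarith)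
    (h₁.trans hMN)
  have has : |a * s| ≤ 3 / 2 * M := by
    rw [abs_mul]
    calc |a| * |s| ≤ (3 / 2 * N) * (M / N) := by gcongr; linarith
      _ = 3 / 2 * M := by rw [mul_assoc, hNδ]
  have hss : s ^ 2 ≤ M := by
    have : |s| ≤ 1 := h₀.trans hδ
    rw [← sq_abs]
    nlinarith [abs_nonneg s]
  refine mul_le_mul (rpow_le_of_comparable k (by norm_num) hN0 hj₁ hj₂)
    (jap_rpow_le b hM hb ?_) (Real.rpow_nonneg (jap_pos _).le _) (by positivity)
  rw [spFreq_sq, tFreq, hζ]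
  rw [abs_le] at *
  constructor <;> nlinarith [sq_nonneg s, sq_nonneg (ζ 1)]

lemma le_wW_of_mem_box {N M l b : ℝ} {ζ : SpaceTime} (hN : 2 ≤ N) (hM : 1 ≤ M) (hMN : M ≤ N)
    (hb : M = 1 ∨ 0 ≤ b) (h₀ : |ζ 0 - (2 * N + 1)| ≤ M / N)
    (h₁ : ζ 1 ^ 2 ≤ M) (h₂ : |ζ 2 + (2 * N + 1)| ≤ M) :
    ((8 ^ |l|)⁻¹ * N ^ l) * ((8 ^ |b|)⁻¹ * M ^ (-b)) * N ≤
      wW l (-b) ζ * (spFreq ζ ^ 2 / jap (spFreq ζ)) := by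
  have hN0 : 0 < N := by linarith
  have hM0 : 0 < M := by linarith
  have hδ : M / N ≤ 1 := (div_le_one hN0).2 hMN
  obtain ⟨h₀l, h₀u⟩ := abs_le.1 (h₀.trans hδ)
  have hζ0 : 0 < ζ 0 := by linarith
  obtain ⟨hj₁, hj₂⟩ := jap_spFreq_comparable (ζ := ζ) hN (by rw [abs_of_pos hζ0]; linarith)
    (by rw [abs_of_pos hζ0]; linarith) (h₁.trans hMN)
  have hX := abs_le_spFreq ζ
  rw [abs_of_pos hζ0] at hX
  have hXsq := spFreq_sq ζ
  have hXu : spFreq ζ ≤ ζ 0 + M := by nlinarith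
  have hsym : N ≤ spFreq ζ ^ 2 / jap (spFreq ζ) := by
    rw [le_div_iff₀ (jap_pos _)]
    have := jap_le (le_refl |spFreq ζ|)
    rw [abs_of_nonneg (by linarith : 0 ≤ spFreq ζ)] at this
    nlinarith
  refine mul_le_mul (mul_le_mul (le_rpow_of_comparable l (by norm_num) hN0 hj₁ hj₂)
    (le_jap_rpow_neg b hM hb ?_) (by positivity) (Real.rpow_nonneg (jap_pos _).le _))
    hsym hN0.le (mul_nonneg (Real.rpow_nonneg (jap_pos _).le _)
      (Real.rpow_nonneg (jap_pos _).le _))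
  rw [tFreq]
  rw [abs_le] at *
  constructor <;> linarith

lemma exists_power_bound (k ℓ b' b₁ b₂ C : ℝ) (hC : ∀ u w : SchwartzMap SpaceTime ℂ,
      XWn ℓ (-b') (DeltaOp fun ζ => u ζ * (starRingEnd ℂ) (w ζ)) ≤
        ENNReal.ofReal C * XSn k b₁ ⇑u * XSn k b₂ ⇑w) :
    ∃ K : ℝ, ∀ N M : ℝ, 2 ≤ N → 1 ≤ M → M ≤ N → (M = 1 ∨ 0 ≤ b' ∧ 0 ≤ b₁ ∧ 0 ≤ b₂) →
      N ^ (ℓ - 2 * k + 1 / 2) * M ^ (5 / 4 - (b' + b₁ + b₂)) ≤ K := by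
  obtain ⟨K, hK, h⟩ := exists_bilinear_test_bound k ℓ b' b₁ b₂ C hC
  refine ⟨K * (8 ^ |k| * 8 ^ |k| * 8 ^ |b₁| * 8 ^ |b₂| * 8 ^ |ℓ| * 8 ^ |b'|), ?_⟩
  intro N M hN hM hMN hb
  have hN0 : 0 < N := by linarith
  have hM0 : 0 < M := by linarith
  obtain ⟨D, hD, hdet, hbox⟩ := exists_box_dilation hN0 hM0
  have key := h D hD !₂[N + 1, 0, -(N + 1) ^ 2] !₂[-N, 0, -N ^ 2]
    (((8 ^ |ℓ|)⁻¹ * N ^ ℓ) * ((8 ^ |b'|)⁻¹ * M ^ (-b')) * N)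
    ((8 ^ |k| * N ^ k) * (8 ^ |b₁| * M ^ b₁)) ((8 ^ |k| * N ^ k) * (8 ^ |b₂| * M ^ b₂))
    (by positivity) (by positivity) (by positivity)
    (fun ζ hζ => by
      obtain ⟨h0, h1, h2⟩ := hbox _ hζ
      simp at h0 h1 h2
      refine wS_le_of_mem_box (a := N + 1) hN hM hMN (hb.imp_right fun h => h.2.1) ?_ ?_ h0 h1 h2
      · rw [abs_of_pos (by linarith)]
        linarith
      · rw [abs_of_pos (by linarith)])
    (fun ζ hζ => by
      obtain ⟨h0, h1, h2⟩ := hbox _ hζ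
      refine wS_le_of_mem_box (a := -N) hN hM hMN (hb.imp_right fun h => h.2.2) ?_ ?_
        (by simpa using h0) (by simpa using h1) (by simpa using h2)
      · rw [abs_neg, abs_of_pos (by linarith)]
      · rw [abs_neg, abs_of_pos (by linarith)]
        linarith)
    (fun ζ hζ => by
      obtain ⟨h0, h1, h2⟩ := hbox _ hζ
      refine le_wW_of_mem_box hN hM hMN (hb.imp_right fun h => h.1) ?_ (by simpa using h1) ?_
      · convert h0 using 2
        simp
        ring
      · convert h2 using 2
        simp
        ring)
  rw [hdet] at key
  have e1 : N ^ (ℓ - 2 * k + 1 / 2) = N ^ ℓ * N * N ^ (-1 / 2 : ℝ) / (N ^ k * N ^ k) := by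
    rw [eq_div_iff (by positivity)]
    simp only [← Real.rpow_add_one hN0.ne', ← Real.rpow_add hN0]
    congr 1
    ring
  have e2 : M ^ (5 / 4 - (b' + b₁ + b₂)) =
      M ^ (-b') * M ^ (5 / 4 : ℝ) / (M ^ b₁ * M ^ b₂) := by
    rw [eq_div_iff (by positivity)]
    simp only [← Real.rpow_add hM0]
    congr 1
    ring
  rw [e1, e2, div_mul_div_comm, div_le_iff₀ (by positivity)]
  have h8 : 0 < (8 : ℝ) ^ |ℓ| * 8 ^ |b'| := by positivity
  have key' := mul_le_mul_of_nonneg_right key h8.le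
  refine le_trans (le_of_eq ?_) (key'.trans (le_of_eq ?_))
  · field_simp
  · ring

/-- Failure of the wave bilinear estimate below the threshold. -/
theorem failure_wave_bilinear (k ℓ b' b₁ b₂ : ℝ)
    (h : 0 < ℓ - 2 * k + 1 / 2 ∨
      (ℓ - 2 * k + 1 / 2 = 0 ∧ 0 ≤ b' ∧ 0 ≤ b₁ ∧ 0 ≤ b₂ ∧ b' + b₁ + b₂ < 5 / 4)) :
    ¬ ∃ C : ℝ, ∀ u w : SchwartzMap SpaceTime ℂ,
        XWn ℓ (-b') (DeltaOp fun ζ => u ζ * (starRingEnd ℂ) (w ζ)) ≤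
          ENNReal.ofReal C * XSn k b₁ ⇑u * XSn k b₂ ⇑w := by
  rintro ⟨C, hC⟩
  obtain ⟨K, hK⟩ := exists_power_bound k ℓ b' b₁ b₂ C hC
  have large : ∀ e : ℝ, 0 < e → ∃ N : ℝ, 2 ≤ N ∧ K < N ^ e := fun e he =>
    ((Filter.eventually_ge_atTop 2).and
      ((tendsto_rpow_atTop he).eventually_gt_atTop K)).exists
  rcases h with h | ⟨h0, hb', hb₁, hb₂, hlt⟩
  · obtain ⟨N, hN, hlarge⟩ := large _ h
    have := hK N 1 hN le_rfl (by linarith) (.inl rfl)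
    rw [Real.one_rpow, mul_one] at this
    linarith
  · obtain ⟨N, hN, hlarge⟩ := large (5 / 4 - (b' + b₁ + b₂)) (by linarith)
    have := hK N N hN (by linarith) le_rfl (.inr ⟨hb', hb₁, hb₂⟩)
    rw [h0, Real.rpow_zero, one_mul] at this
    linarith
end
end

section
/- (Orthogonality/localization lemma.) Let N₁ ≥ 1, A ≥ 1, and k ∈ ℝ. For j ∈ ℤ let I_j = [A⁻¹(j−1/2), A⁻¹(j+1/2)]. Then there exists a map j ↦ k(j) on ℤ such that: (a) whenever x,y ≥ 0 satisfy k ≤ x²−y² ≤ k + N₁A⁻¹ and N₁/4 ≤ x,y ≤ 4N₁ and y ∈ I_j, it follows that x ∈ I_{k(j)−100} ∪ I_{k(j)−99} ∪ ⋯ ∪ I_{k(j)+100}; and (b) for every m ∈ ℤ, the set {j ∈ ℤ : I_j ∩ [N₁/4, 4N₁] ≠ ∅ and k(j) = m} has at most 100 elements. -/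
noncomputable section

/-- Orthogonality/localization lemma: the intervals I_j = [A⁻¹(j−1/2), A⁻¹(j+1/2)]. -/
def Ij (A : ℝ) (j : ℤ) : Set ℝ := Set.Icc (((j : ℝ) - 1 / 2) / A) (((j : ℝ) + 1 / 2) / A)

/-- The rescaled pair `(A * x, A * y)` in the support of the `j`-th piece, with `N = A * N₁`
and `κ = A ^ 2 * k`. -/
def IsLocalizedPair (N κ : ℝ) (j : ℤ) (X Y : ℝ) : Prop :=
  κ ≤ X ^ 2 - Y ^ 2 ∧ X ^ 2 - Y ^ 2 ≤ κ + N ∧ N / 4 ≤ X ∧ X ≤ 4 * N ∧ N / 4 ≤ Y ∧ Y ≤ 4 * N ∧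
    |Y - j| ≤ 1 / 2

theorem mem_Ij_iff {A : ℝ} (hA : 0 < A) (x : ℝ) (j : ℤ) : x ∈ Ij A j ↔ |A * x - j| ≤ 1 / 2 := by
  rw [Ij, Set.mem_Icc, div_le_iff₀ hA, le_div_iff₀ hA, abs_le, mul_comm x A]
  constructor <;> rintro ⟨h₁, h₂⟩ <;> constructor <;> linarith

theorem isLocalizedPair_of_mem_Ij {N₁ A k x y : ℝ} {j : ℤ} (hA : 0 < A)
    (h₁ : k ≤ x ^ 2 - y ^ 2) (h₂ : x ^ 2 - y ^ 2 ≤ k + N₁ / A)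
    (hx₁ : N₁ / 4 ≤ x) (hx₂ : x ≤ 4 * N₁) (hy₁ : N₁ / 4 ≤ y) (hy₂ : y ≤ 4 * N₁)
    (hj : y ∈ Ij A j) : IsLocalizedPair (A * N₁) (A ^ 2 * k) j (A * x) (A * y) := by
  have hA2 : 0 ≤ A ^ 2 := sq_nonneg A
  have e : A ^ 2 * (k + N₁ / A) = A ^ 2 * k + A * N₁ := by field_simp
  have h₁' := mul_le_mul_of_nonneg_left h₁ hA2
  have h₂' := mul_le_mul_of_nonneg_left h₂ hA2
  have hx₁' := mul_le_mul_of_nonneg_left hx₁ hA.le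
  have hx₂' := mul_le_mul_of_nonneg_left hx₂ hA.le
  have hy₁' := mul_le_mul_of_nonneg_left hy₁ hA.le
  have hy₂' := mul_le_mul_of_nonneg_left hy₂ hA.le
  exact ⟨by linarith, by linarith, by linarith, by linarith, by linarith, by linarith,
    (mem_Ij_iff hA y j).1 hj⟩

theorem sub_le_of_sq_sub_sq_le {N a b : ℝ} (hN : 0 < N) (hb : N / 4 ≤ b)
    (h : a ^ 2 - b ^ 2 ≤ 9 * N) : a - b ≤ 18 := by
  by_contra! hab
  nlinarith [mul_pos (sub_pos.2 hab) hN,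
    mul_nonneg (by linarith : 0 ≤ a - b) (by linarith : 0 ≤ a + b - N / 2)]

theorem sq_sub_sq_le {N a b : ℝ} (hN : 0 < N) (ha : N / 4 ≤ a) (hb : N / 4 ≤ b)
    (ha' : a ≤ 4 * N) (hb' : b ≤ 4 * N) (h : a - b ≤ 1) : a ^ 2 - b ^ 2 ≤ 8 * N := by
  nlinarith [mul_nonneg (sub_nonneg.2 h) (by linarith : 0 ≤ a + b)]

namespace IsLocalizedPair

variable {N κ X Y X' Y' : ℝ} {i j : ℤ}

theorem sub_fst_le (hN : 0 < N) (h : IsLocalizedPair N κ j X Y)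
    (h' : IsLocalizedPair N κ j X' Y') : X - X' ≤ 18 := by
  obtain ⟨-, h₂, hX, -, hY, hY₂, hj⟩ := h
  obtain ⟨h₁', -, hX', -, hY', hY₂', hj'⟩ := h'
  rw [abs_le] at hj hj'
  have := sq_sub_sq_le hN hY hY' hY₂ hY₂' (by linarith)
  exact sub_le_of_sq_sub_sq_le hN hX' (by linarith)

theorem sub_snd_le (hN : 0 < N) (h : IsLocalizedPair N κ i X Y)
    (h' : IsLocalizedPair N κ j X' Y') (hX : X - X' ≤ 1) : Y - Y' ≤ 18 := by
  obtain ⟨h₁, -, hX₁, hX₂, hY, -, -⟩ := h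
  obtain ⟨-, h₂', hX₁', hX₂', hY', -, -⟩ := h'
  have := sq_sub_sq_le hN hX₁ hX₁' hX₂ hX₂' hX
  exact sub_le_of_sq_sub_sq_le hN hY' (by linarith)

theorem index_sub_le (hN : 0 < N) (h : IsLocalizedPair N κ i X Y)
    (h' : IsLocalizedPair N κ j X' Y') (hX : round X = round X') : i - j ≤ 19 := by
  have hr := abs_le.1 (abs_sub_round X)
  have hr' := abs_le.1 (abs_sub_round X')
  rw [hX] at hr
  have := h.sub_snd_le hN h' (by linarith)
  have hi := abs_le.1 h.2.2.2.2.2.2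
  have hj := abs_le.1 h'.2.2.2.2.2.2
  have : (i : ℝ) - j ≤ 19 := by linarith
  exact_mod_cast this

end IsLocalizedPair

open Classical in
/-- The index of the unit interval containing the first coordinate of some localized pair
over `j`, and `j` itself if there is no such pair. -/
def localizedIndex (N κ : ℝ) (j : ℤ) : ℤ :=
  if h : ∃ X Y, IsLocalizedPair N κ j X Y then round h.choose else j

theorem localizedIndex_eq_or (N κ : ℝ) (j : ℤ) :
    (∃ X Y, IsLocalizedPair N κ j X Y ∧ localizedIndex N κ j = round X) ∨
      ((¬∃ X Y, IsLocalizedPair N κ j X Y) ∧ localizedIndex N κ j = j) := by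
  by_cases h : ∃ X Y, IsLocalizedPair N κ j X Y
  · obtain ⟨Y, hY⟩ := h.choose_spec
    exact .inl ⟨_, Y, hY, dif_pos h⟩
  · exact .inr ⟨h, dif_neg h⟩

theorem abs_round_sub_localizedIndex_le {N κ X Y : ℝ} {j : ℤ} (hN : 0 < N)
    (h : IsLocalizedPair N κ j X Y) : |round X - localizedIndex N κ j| ≤ 19 := by
  rcases localizedIndex_eq_or N κ j with ⟨X', Y', h', e⟩ | ⟨hn, -⟩
  · rw [e]
    have h₁ := h.sub_fst_le hN h'
    have h₂ := h'.sub_fst_le hN h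
    have hr := abs_le.1 (abs_sub_round X)
    have hr' := abs_le.1 (abs_sub_round X')
    have : |(round X : ℝ) - round X'| ≤ 19 := abs_le.2 ⟨by linarith, by linarith⟩
    exact_mod_cast this
  · exact absurd ⟨X, Y, h⟩ hn

theorem exists_fiber_localizedIndex_subset {N : ℝ} (κ : ℝ) (hN : 0 < N) (m : ℤ) :
    ∃ j₀ : ℤ, {j | localizedIndex N κ j = m} ⊆
      (insert m (Finset.Icc (j₀ - 19) (j₀ + 19)) : Finset ℤ) := by
  by_cases hg : ∃ j₀ X Y, IsLocalizedPair N κ j₀ X Y ∧ round X = m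
  · obtain ⟨j₀, X, Y, h, e⟩ := hg
    refine ⟨j₀, fun j hj => ?_⟩
    rw [Set.mem_ofPred_eq] at hj
    rw [Finset.mem_coe, Finset.mem_insert, Finset.mem_Icc]
    rcases localizedIndex_eq_or N κ j with ⟨X', Y', h', e'⟩ | ⟨-, e'⟩
    · have hX : round X = round X' := by rw [e, ← e', hj]
      have := h.index_sub_le hN h' hX
      have := h'.index_sub_le hN h hX.symm
      omega
    · omega
  · refine ⟨0, fun j hj => ?_⟩
    rw [Set.mem_ofPred_eq] at hj
    rcases localizedIndex_eq_or N κ j with ⟨X', Y', h', e'⟩ | ⟨-, e'⟩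
    · exact absurd ⟨j, X', Y', h', e'.symm.trans hj⟩ hg
    · exact Finset.mem_insert.2 (.inl (e'.symm.trans hj))

theorem orthogonality_localization (N₁ A k : ℝ) (hN₁ : 1 ≤ N₁) (hA : 1 ≤ A) :
    ∃ K : ℤ → ℤ,
      (∀ x y : ℝ, ∀ j : ℤ,
        0 ≤ x → 0 ≤ y →
        k ≤ x ^ 2 - y ^ 2 → x ^ 2 - y ^ 2 ≤ k + N₁ / A →
        N₁ / 4 ≤ x → x ≤ 4 * N₁ → N₁ / 4 ≤ y → y ≤ 4 * N₁ →
        y ∈ Ij A j →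
        ∃ i : ℤ, K j - 100 ≤ i ∧ i ≤ K j + 100 ∧ x ∈ Ij A i) ∧
      ∀ m : ℤ,
        {j : ℤ | (Ij A j ∩ Set.Icc (N₁ / 4) (4 * N₁)).Nonempty ∧ K j = m}.Finite ∧
        {j : ℤ | (Ij A j ∩ Set.Icc (N₁ / 4) (4 * N₁)).Nonempty ∧ K j = m}.ncard ≤ 100 := by
  have hA₀ : 0 < A := by linarith
  have hN : 0 < A * N₁ := by positivity
  refine ⟨localizedIndex (A * N₁) (A ^ 2 * k), ?_, fun m => ?_⟩
  · intro x y j _ _ h₁ h₂ hx₁ hx₂ hy₁ hy₂ hj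
    have h := isLocalizedPair_of_mem_Ij hA₀ h₁ h₂ hx₁ hx₂ hy₁ hy₂ hj
    have hr := abs_le.1 (abs_round_sub_localizedIndex_le hN h)
    exact ⟨round (A * x), by omega, by omega, (mem_Ij_iff hA₀ x _).2 (abs_sub_round _)⟩
  · obtain ⟨j₀, hj₀⟩ := exists_fiber_localizedIndex_subset (A ^ 2 * k) hN m
    have hsub := Set.Subset.trans (fun j (hj : (Ij A j ∩ Set.Icc (N₁ / 4) (4 * N₁)).Nonempty ∧
      localizedIndex (A * N₁) (A ^ 2 * k) j = m) => hj.2) hj₀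
    refine ⟨(Finset.finite_toSet _).subset hsub,
      (Set.ncard_le_ncard hsub (Finset.finite_toSet _)).trans ?_⟩
    rw [Set.ncard_coe_finset]
    refine (Finset.card_insert_le _ _).trans ?_
    rw [Int.card_Icc]
    omega
end
end
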